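/- arXiv:1306.5302 — 4 statements merged into one kernel-verified Lean document; each statement's English description precedes it below -/
import Mathlib

section
/- In a discrete-time market of n stocks with positive market capitalisations in which stock j pays a dividend rate δ_j(t1) ∈ ℝ over the period (t0, t1], define the market dividend rate δ(t1) = log(Σ_{j=1}^n μ_j(t1) e^{δ_j(t1)}). Then for any ranking permutations p_{t0}, p_{t1} and any rank i, writing j = p_{t0}(i), the dividend-inclusive return of stock j relative to the dividend-inclusive market return factorises as distribution plus rank plus a dividend correction: log(X_j(t1) e^{δ_j(t1)} / X_j(t0)) − log((Σ_{l=1}^n X_l(t1) e^{δ_l(t1)}) / M(t0)) = log(μ_{p_{t1}(i)}(t1)/μ_{p_{t0}(i)}(t0)) + log(μ_{p_{t0}(i)}(t1)/μ_{p_{t1}(i)}(t1)) + (δ_j(t1) − δ(t1)). -/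
/-- Market weight of stock `i` at time `t`: `μ_i(t) = X_i(t) / M(t)`
where `M(t) = Σ_j X_j(t)`. -/
noncomputable def marketWeight {n : ℕ} (X : ℕ → Fin n → ℝ) (t : ℕ) (i : Fin n) : ℝ :=
  X t i / ∑ j, X t j

/-- The weighted average of `f` under the market weights is the capitalisation-weighted total of
`f` divided by the total capitalisation. -/
theorem sum_marketWeight_mul {n : ℕ} (X : ℕ → Fin n → ℝ) (t : ℕ) (f : Fin n → ℝ) :
    ∑ j, marketWeight X t j * f j = (∑ j, X t j * f j) / ∑ j, X t j := by
  simp only [marketWeight, div_mul_eq_mul_div, Finset.sum_div]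

/-- With dividend rates `δ_j(t1)` over `(t0, t1]` and market dividend rate
`δ(t1) = log (Σ_j μ_j(t1) e^{δ_j(t1)})`, the dividend-inclusive return of the stock
occupying rank `i` at time `t0` relative to the dividend-inclusive market return
factorises as distribution plus rank plus a dividend correction. -/
theorem return_factorisation_with_dividends
    {n : ℕ} (X : ℕ → Fin n → ℝ) (hX : ∀ t i, 0 < X t i) (t0 t1 : ℕ)
    (δ : Fin n → ℝ)
    (p0 p1 : Equiv.Perm (Fin n))
    (hp0 : ∀ i j : Fin n, i ≤ j → marketWeight X t0 (p0 j) ≤ marketWeight X t0 (p0 i))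
    (hp1 : ∀ i j : Fin n, i ≤ j → marketWeight X t1 (p1 j) ≤ marketWeight X t1 (p1 i))
    (i : Fin n)
    (δM : ℝ) (hδM : δM = Real.log (∑ j, marketWeight X t1 j * Real.exp (δ j))) :
    Real.log (X t1 (p0 i) * Real.exp (δ (p0 i)) / X t0 (p0 i)) -
        Real.log ((∑ l, X t1 l * Real.exp (δ l)) / ∑ l, X t0 l) =
      Real.log (marketWeight X t1 (p1 i) / marketWeight X t0 (p0 i)) +
        Real.log (marketWeight X t1 (p0 i) / marketWeight X t1 (p1 i)) +
          (δ (p0 i) - δM) := by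
  have hM (t : ℕ) : ∑ l, X t l ≠ 0 :=
    (Finset.sum_pos (fun l _ => hX t l) ⟨i, Finset.mem_univ i⟩).ne'
  have hD : ∑ l, X t1 l * Real.exp (δ l) ≠ 0 :=
    (Finset.sum_pos (fun l _ => mul_pos (hX t1 l) (Real.exp_pos _)) ⟨i, Finset.mem_univ i⟩).ne'
  have hne (t : ℕ) (j : Fin n) : X t j ≠ 0 := (hX t j).ne'
  have hw (t : ℕ) (j : Fin n) : marketWeight X t j ≠ 0 := div_ne_zero (hne t j) (hM t)
  have hlog (t : ℕ) (j : Fin n) :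
      Real.log (marketWeight X t j) = Real.log (X t j) - Real.log (∑ l, X t l) :=
    Real.log_div (hne t j) (hM t)
  rw [hδM, sum_marketWeight_mul,
    Real.log_div (mul_ne_zero (hne _ _) (Real.exp_ne_zero _)) (hne _ _),
    Real.log_mul (hne _ _) (Real.exp_ne_zero _), Real.log_exp,
    Real.log_div hD (hM t0), Real.log_div hD (hM t1),
    Real.log_div (hw _ _) (hw _ _), Real.log_div (hw _ _) (hw _ _)]
  simp only [hlog]
  ring
end

section
/- (Special-case size effect.) In a discrete-time market of n stocks with positive market capitalisations, fix 1 ≤ m < n, let p_{t0} and p_{t1} be ranking permutations at times t0 and t1, let Z_L(t) = Σ_{k=1}^m X_{p_t(k)}(t) and Z_S(t) = Σ_{k=m+1}^n X_{p_t(k)}(t), and define the buy-and-hold returns r_L(t1) = log((Σ_{k=1}^m X_{p_{t0}(k)}(t1)) / Z_L(t0)) and r_S(t1) = log((Σ_{k=m+1}^n X_{p_{t0}(k)}(t1)) / Z_S(t0)). If the capitalisation ratios of the rebalanced portfolios are unchanged, i.e. Z_L(t1)/Z_L(t0) = Z_S(t1)/Z_S(t0), then r_S(t1) ≥ r_L(t1):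 the small portfolio's return is at least that of the large portfolio. -/
/-- Among all rearrangements of an antitone sequence, the antitone one has the largest
sum over the first `m` indices. -/
theorem sum_comp_perm_le_sum_of_antitone {n : ℕ} {f : Fin n → ℝ} (hf : Antitone f)
    (σ : Equiv.Perm (Fin n)) (m : ℕ) :
    ∑ k ∈ Finset.univ.filter (fun k : Fin n => (k : ℕ) < m), f (σ k) ≤
      ∑ k ∈ Finset.univ.filter (fun k : Fin n => (k : ℕ) < m), f k := by
  have hg : Antitone (fun k : Fin n => if (k : ℕ) < m then (1 : ℝ) else 0) := by
    intro i j hij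
    have hij' : (i : ℕ) ≤ j := hij
    dsimp only
    split_ifs
    · exact le_rfl
    · omega
    · exact zero_le_one
    · exact le_rfl
  simpa [Finset.sum_filter] using (hg.monovary hf).sum_mul_comp_perm_le_sum_mul (σ := σ)

/-- Special-case size effect: if the capitalisation ratios of the rebalanced large and
small portfolios are unchanged, `Z_L(t1)/Z_L(t0) = Z_S(t1)/Z_S(t0)`, then the
buy-and-hold return of the small portfolio is at least that of the large portfolio. -/
theorem size_effect_special_case
    {n : ℕ} (X : ℕ → Fin n → ℝ) (hX : ∀ t i, 0 < X t i) (t0 t1 : ℕ)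
    (m : ℕ) (hm1 : 1 ≤ m) (hmn : m < n)
    (p0 p1 : Equiv.Perm (Fin n))
    (hp0 : ∀ i j : Fin n, i ≤ j → X t0 (p0 j) ≤ X t0 (p0 i))
    (hp1 : ∀ i j : Fin n, i ≤ j → X t1 (p1 j) ≤ X t1 (p1 i))
    (hratio :
      (∑ k ∈ Finset.univ.filter (fun k : Fin n => (k : ℕ) < m), X t1 (p1 k)) /
          (∑ k ∈ Finset.univ.filter (fun k : Fin n => (k : ℕ) < m), X t0 (p0 k)) =
        (∑ k ∈ Finset.univ.filter (fun k : Fin n => m ≤ (k : ℕ)), X t1 (p1 k)) /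
          (∑ k ∈ Finset.univ.filter (fun k : Fin n => m ≤ (k : ℕ)), X t0 (p0 k))) :
    Real.log ((∑ k ∈ Finset.univ.filter (fun k : Fin n => (k : ℕ) < m), X t1 (p0 k)) /
        ∑ k ∈ Finset.univ.filter (fun k : Fin n => (k : ℕ) < m), X t0 (p0 k)) ≤
      Real.log ((∑ k ∈ Finset.univ.filter (fun k : Fin n => m ≤ (k : ℕ)), X t1 (p0 k)) /
        ∑ k ∈ Finset.univ.filter (fun k : Fin n => m ≤ (k : ℕ)), X t0 (p0 k)) := by
  have hlarge := sum_comp_perm_le_sum_of_antitone (f := fun k => X t1 (p1 k))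
    (fun i j h => hp1 i j h) (p0.trans p1.symm) m
  simp only [Equiv.trans_apply, Equiv.apply_symm_apply] at hlarge
  have hsplit (p : Equiv.Perm (Fin n)) :
      (∑ k ∈ Finset.univ.filter (fun k : Fin n => (k : ℕ) < m), X t1 (p k)) +
        (∑ k ∈ Finset.univ.filter (fun k : Fin n => m ≤ (k : ℕ)), X t1 (p k)) =
      ∑ i, X t1 i := by
    rw [← Equiv.sum_comp p (X t1)]
    simpa only [not_lt] using
      Finset.sum_filter_add_sum_filter_not Finset.univ (fun k : Fin n => (k : ℕ) < m)
        (fun k => X t1 (p k))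
  have hsmall :
      ∑ k ∈ Finset.univ.filter (fun k : Fin n => m ≤ (k : ℕ)), X t1 (p1 k) ≤
        ∑ k ∈ Finset.univ.filter (fun k : Fin n => m ≤ (k : ℕ)), X t1 (p0 k) := by
    linarith [hsplit p0, hsplit p1]
  have hpos (t : ℕ) :
      0 < ∑ k ∈ Finset.univ.filter (fun k : Fin n => (k : ℕ) < m), X t (p0 k) :=
    Finset.sum_pos (fun _ _ => hX _ _) ⟨⟨0, by omega⟩, by simp; omega⟩
  refine Real.log_le_log (div_pos (hpos t1) (hpos t0)) ?_
  refine (div_le_div_of_nonneg_right hlarge (hpos t0).le).trans (hratio.trans_le ?_)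
  exact div_le_div_of_nonneg_right hsmall (Finset.sum_nonneg fun _ _ => (hX _ _).le)
end

section
/- (Strict size effect.) Under the hypotheses of the special-case size effect, suppose in addition that the capitalisations X_1(t1),…,X_n(t1) at time t1 are pairwise distinct and that the set of indices of the m largest stocks at time t1 differs from the set of indices of the m largest stocks at time t0, i.e. {p_{t1}(1),…,p_{t1}(m)} ≠ {p_{t0}(1),…,p_{t0}(m)}. If Z_L(t1)/Z_L(t0) = Z_S(t1)/Z_S(t0), then r_S(t1) > r_L(t1) strictly. -/
/-- If `f` is at least `c` on `A` and below `c` off `A`, then `A` has a strictly larger sum of `f`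
than any other finset of the same cardinality. -/
theorem Finset.sum_lt_sum_of_card_eq_of_threshold {ι : Type*} [DecidableEq ι] {A B : Finset ι}
    {f : ι → ℝ} {c : ℝ} (hcard : A.card = B.card) (hne : A ≠ B)
    (hA : ∀ i ∈ A, c ≤ f i) (hB : ∀ i, i ∉ A → f i < c) :
    ∑ i ∈ B, f i < ∑ i ∈ A, f i := by
  have hsdiff : (B \ A).Nonempty := by
    rw [Finset.sdiff_nonempty]
    exact fun h => hne (Finset.eq_of_subset_of_card_le h hcard.le).symm
  have hlt : ∑ i ∈ B \ A, f i < ∑ i ∈ A \ B, f i :=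
    calc ∑ i ∈ B \ A, f i < ∑ _i ∈ B \ A, c :=
          Finset.sum_lt_sum_of_nonempty hsdiff fun i hi => hB i (Finset.mem_sdiff.1 hi).2
      _ = ∑ _i ∈ A \ B, c := by
          rw [Finset.sum_const, Finset.sum_const, Finset.card_sdiff_comm hcard]
      _ ≤ ∑ i ∈ A \ B, f i :=
          Finset.sum_le_sum fun i hi => hA i (Finset.mem_sdiff.1 hi).1
  have hA' := Finset.sum_inter_add_sum_sdiff A B f
  have hB' := Finset.sum_inter_add_sum_sdiff B A f
  rw [Finset.inter_comm] at hB'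
  linarith

/-- Strict size effect: if moreover the time-`t1` capitalisations are pairwise distinct
and the set of indices of the `m` largest stocks at time `t1` differs from that at time
`t0`, and `Z_L(t1)/Z_L(t0) = Z_S(t1)/Z_S(t0)`, then `r_S(t1) > r_L(t1)` strictly. -/
theorem size_effect_strict
    {n : ℕ} (X : ℕ → Fin n → ℝ) (hX : ∀ t i, 0 < X t i) (t0 t1 : ℕ)
    (m : ℕ) (hm1 : 1 ≤ m) (hmn : m < n)
    (p0 p1 : Equiv.Perm (Fin n))
    (hp0 : ∀ i j : Fin n, i ≤ j → X t0 (p0 j) ≤ X t0 (p0 i))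
    (hp1 : ∀ i j : Fin n, i ≤ j → X t1 (p1 j) ≤ X t1 (p1 i))
    (hdist : Function.Injective (X t1))
    (hdiff :
      (Finset.univ.filter (fun k : Fin n => (k : ℕ) < m)).image p1 ≠
        (Finset.univ.filter (fun k : Fin n => (k : ℕ) < m)).image p0)
    (hratio :
      (∑ k ∈ Finset.univ.filter (fun k : Fin n => (k : ℕ) < m), X t1 (p1 k)) /
          (∑ k ∈ Finset.univ.filter (fun k : Fin n => (k : ℕ) < m), X t0 (p0 k)) =
        (∑ k ∈ Finset.univ.filter (fun k : Fin n => m ≤ (k : ℕ)), X t1 (p1 k)) /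
          (∑ k ∈ Finset.univ.filter (fun k : Fin n => m ≤ (k : ℕ)), X t0 (p0 k))) :
    Real.log ((∑ k ∈ Finset.univ.filter (fun k : Fin n => (k : ℕ) < m), X t1 (p0 k)) /
        ∑ k ∈ Finset.univ.filter (fun k : Fin n => (k : ℕ) < m), X t0 (p0 k)) <
      Real.log ((∑ k ∈ Finset.univ.filter (fun k : Fin n => m ≤ (k : ℕ)), X t1 (p0 k)) /
        ∑ k ∈ Finset.univ.filter (fun k : Fin n => m ≤ (k : ℕ)), X t0 (p0 k)) := by
  set T := Finset.univ.filter (fun k : Fin n => (k : ℕ) < m) with hT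
  set U := Finset.univ.filter (fun k : Fin n => m ≤ (k : ℕ)) with hU
  have total (p : Equiv.Perm (Fin n)) :
      ∑ k ∈ T, X t1 (p k) + ∑ k ∈ U, X t1 (p k) = ∑ i, X t1 i := by
    have h := Finset.sum_filter_add_sum_filter_not Finset.univ (fun k : Fin n => (k : ℕ) < m)
      (fun k => X t1 (p k))
    simp only [not_lt] at h
    rw [hT, hU, h, Equiv.sum_comp p (X t1)]
  have sum_image (p : Equiv.Perm (Fin n)) :
      ∑ i ∈ T.image p, X t1 i = ∑ k ∈ T, X t1 (p k) :=
    Finset.sum_image p.injective.injOn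
  have top_lt : ∑ k ∈ T, X t1 (p0 k) < ∑ k ∈ T, X t1 (p1 k) := by
    rw [← sum_image, ← sum_image]
    refine Finset.sum_lt_sum_of_card_eq_of_threshold (c := X t1 (p1 ⟨m - 1, by omega⟩)) ?_ hdiff
      ?_ ?_
    · rw [Finset.card_image_of_injective _ p1.injective,
        Finset.card_image_of_injective _ p0.injective]
    · intro i hi
      obtain ⟨k, hk, rfl⟩ := Finset.mem_image.1 hi
      have hkm : (k : ℕ) < m := (Finset.mem_filter.1 hk).2
      exact hp1 _ _ (Fin.le_def.2 (Nat.le_sub_one_of_lt hkm))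
    · intro i hi
      obtain ⟨k, rfl⟩ := p1.surjective i
      have hkm : m ≤ (k : ℕ) := by
        by_contra! h
        exact hi (Finset.mem_image_of_mem _ (Finset.mem_filter.2 ⟨Finset.mem_univ _, h⟩))
      refine lt_of_le_of_ne (hp1 _ _ (Fin.le_def.2 (by simp only; omega))) fun h => ?_
      have := congrArg Fin.val (p1.injective (hdist h))
      simp only at this
      omega
  have bot_lt : ∑ k ∈ U, X t1 (p1 k) < ∑ k ∈ U, X t1 (p0 k) := by
    linarith [total p0, total p1]
  have T_pos (t : ℕ) : 0 < ∑ k ∈ T, X t (p0 k) :=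
    Finset.sum_pos (fun k _ => hX t _)
      ⟨⟨0, by omega⟩, Finset.mem_filter.2 ⟨Finset.mem_univ _, by simp only; omega⟩⟩
  have U_pos : 0 < ∑ k ∈ U, X t0 (p0 k) :=
    Finset.sum_pos (fun k _ => hX t0 _)
      ⟨⟨m, hmn⟩, Finset.mem_filter.2 ⟨Finset.mem_univ _, le_rfl⟩⟩
  refine Real.log_lt_log (div_pos (T_pos t1) (T_pos t0)) ?_
  calc _ < _ := div_lt_div_of_pos_right top_lt (T_pos t0)
    _ = _ := hratio
    _ < _ := div_lt_div_of_pos_right bot_lt U_pos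
end

section
/- (Portfolio-level factorisation.) In a discrete-time market of n stocks with positive market capitalisations, let p_{t0} and p_{t1} be ranking permutations at times t0 and t1, let v_1,…,v_n ≥ 0 with not all zero be rank-based position coefficients, and consider the buy-and-hold portfolio V(t0) = Σ_{i=1}^n v_i X_{p_{t0}(i)}(t0), V(t1) = Σ_{i=1}^n v_i X_{p_{t0}(i)}(t1). Then the portfolio's return relative to the market factorises as a distributional component plus a rank component: log(V(t1)/V(t0)) − log(M(t1)/M(t0)) = log((Σ_{i=1}^n v_i μ_{p_{t1}(i)}(t1)) / (Σ_{i=1}^n v_i μ_{p_{t0}(i)}(t0))) + log((Σ_{i=1}^n v_i μ_{p_{t0}(i)}(t1)) / (Σ_{i=1}^n v_i μ_{p_{t1}(i)}(t1))). -/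
theorem sum_mul_marketWeight {n : ℕ} (X : ℕ → Fin n → ℝ) (t : ℕ) (v : Fin n → ℝ)
    (p : Equiv.Perm (Fin n)) :
    ∑ i, v i * marketWeight X t (p i) = (∑ i, v i * X t (p i)) / ∑ j, X t j := by
  simp only [marketWeight, Finset.sum_div, mul_div_assoc]

theorem sum_mul_comp_perm_pos {ι : Type*} [Fintype ι] {v x : ι → ℝ} (hv : ∀ i, 0 ≤ v i)
    (hv' : ∃ i, 0 < v i) (hx : ∀ i, 0 < x i) (p : Equiv.Perm ι) :
    0 < ∑ i, v i * x (p i) := by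
  obtain ⟨k, hk⟩ := hv'
  exact Finset.sum_pos' (fun i _ => mul_nonneg (hv i) (hx _).le)
    ⟨k, Finset.mem_univ k, mul_pos hk (hx _)⟩

/-- Portfolio-level factorisation: for a buy-and-hold portfolio with nonnegative,
not-all-zero rank-based positions `v`, held by time-`t0` ranks, the return relative to
the market factorises as a distributional component plus a rank (sensitivity)
component. -/
theorem portfolio_return_factorisation
    {n : ℕ} (X : ℕ → Fin n → ℝ) (hX : ∀ t i, 0 < X t i) (t0 t1 : ℕ)
    (p0 p1 : Equiv.Perm (Fin n))
    (hp0 : ∀ i j : Fin n, i ≤ j → marketWeight X t0 (p0 j) ≤ marketWeight X t0 (p0 i))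
    (hp1 : ∀ i j : Fin n, i ≤ j → marketWeight X t1 (p1 j) ≤ marketWeight X t1 (p1 i))
    (v : Fin n → ℝ) (hv : ∀ i, 0 ≤ v i) (hv0 : ∃ i, v i ≠ 0) :
    Real.log ((∑ i, v i * X t1 (p0 i)) / ∑ i, v i * X t0 (p0 i)) -
        Real.log ((∑ j, X t1 j) / ∑ j, X t0 j) =
      Real.log ((∑ i, v i * marketWeight X t1 (p1 i)) /
          ∑ i, v i * marketWeight X t0 (p0 i)) +
        Real.log ((∑ i, v i * marketWeight X t1 (p0 i)) /
          ∑ i, v i * marketWeight X t1 (p1 i)) := by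
  obtain ⟨k, hk⟩ := hv0
  have hvk : ∃ i, 0 < v i := ⟨k, (hv k).lt_of_ne' hk⟩
  have hM : ∀ t, (∑ j, X t j) ≠ 0 := fun t =>
    (Finset.sum_pos (fun i _ => hX t i) ⟨k, Finset.mem_univ k⟩).ne'
  have hV := fun t p => (sum_mul_comp_perm_pos hv hvk (hX t) p).ne'
  simp only [sum_mul_marketWeight]
  rw [Real.log_div (hV _ _) (hV _ _), Real.log_div (hM _) (hM _),
    Real.log_div (div_ne_zero (hV _ _) (hM _)) (div_ne_zero (hV _ _) (hM _)),
    Real.log_div (div_ne_zero (hV _ _) (hM _)) (div_ne_zero (hV _ _) (hM _)),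
    Real.log_div (hV _ _) (hM _), Real.log_div (hV _ _) (hM _), Real.log_div (hV _ _) (hM _)]
  ring
end
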